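/- arXiv:1905.10879 — 2 statements merged into one kernel-verified Lean document; each statement's English description precedes it below -/
import Mathlib

section
/- Let p be a prime and let N ≥ 4 be an integer. The p-adic Koba-Nielsen local zeta function Z_{ℚ_p}^(N)(s), defined with the p-adic absolute value and the additive Haar measure on ℚ_p normalized so that ℤ_p has measure 1, converges (i.e., the integrand is absolutely integrable over ℚ_p^{N-3}) for all s = (s_{ij}) ∈ ℂ^{N(N-3)/2} satisfying −2/(N−2) < Re(s_{ij}) < −2/N for every index pair ij. -/
open MeasureTheory Finset

/-- The integrand of the `p`-adic Koba-Nielsen local zeta function `Z_{ℚ_p}^(N)(s)`,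
defined with the `p`-adic absolute value `‖·‖`. The variables `x 0, …, x (N-4)` represent
`x_2, …, x_{N-2}`; `a j` is `s_{1,(j+2)}`, `b j` is `s_{(N-1),(j+2)}`, and `c i j`
(for `i < j`) is `s_{(i+2),(j+2)}`. For `t ≠ 0`,
`(‖t‖ : ℂ) ^ s = ‖t‖^{Re s} e^{i Im s log ‖t‖}`. -/
noncomputable def KNintegrandPadic (p : ℕ) [Fact p.Prime] (N : ℕ)
    (a b : Fin (N - 3) → ℂ) (c : Fin (N - 3) → Fin (N - 3) → ℂ)
    (x : Fin (N - 3) → ℚ_[p]) : ℂ :=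
  (∏ j, ((‖x j‖ : ℝ) : ℂ) ^ a j) * (∏ j, ((‖1 - x j‖ : ℝ) : ℂ) ^ b j) *
    ∏ q ∈ Finset.univ.filter (fun q : Fin (N - 3) × Fin (N - 3) => q.1 < q.2),
      ((‖x q.1 - x q.2‖ : ℝ) : ℂ) ^ c q.1 q.2

section Measure

variable {p : ℕ} [Fact p.Prime]

/-- A closed ball of radius `p ^ (k + 1)` is the union of the translates of a ball of radius `p ^ k`
by the digits `i * p ^ (-(k + 1))`, `i < p`. -/
lemma padic_ball_succ_eq_iUnion (k : ℤ) :
    {x : ℚ_[p] | ‖x‖ ≤ (p : ℝ) ^ (k + 1)} =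
      ⋃ i : Fin p, (fun x => -((i : ℕ) * (p : ℚ_[p]) ^ (-(k + 1))) + x) ⁻¹'
        {x : ℚ_[p] | ‖x‖ ≤ (p : ℝ) ^ k} := by
  have hp0 : (0 : ℝ) < p := by exact_mod_cast (Fact.out : p.Prime).pos
  have hp1 : (1 : ℝ) ≤ p := by exact_mod_cast (Fact.out : p.Prime).one_le
  have hpq : (p : ℚ_[p]) ≠ 0 := by exact_mod_cast (Fact.out : p.Prime).ne_zero
  ext x
  simp only [Set.mem_ofPred_eq, Set.mem_iUnion, Set.mem_preimage]
  constructor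
  · intro hx
    have hy : ‖x * (p : ℚ_[p]) ^ (k + 1)‖ ≤ 1 := by
      rw [norm_mul, Padic.norm_p_zpow, zpow_neg]
      exact mul_inv_le_one_of_le₀ hx (by positivity)
    obtain ⟨n, hn, hn'⟩ := PadicInt.exists_mem_range (⟨_, hy⟩ : ℤ_[p])
    refine ⟨⟨n, hn⟩, ?_⟩
    have h1 : ‖x * (p : ℚ_[p]) ^ (k + 1) - n‖ < (p : ℝ) ^ (0 : ℤ) := by
      rw [zpow_zero]
      exact PadicInt.mem_nonunits.1 hn'
    rw [Padic.norm_lt_pow_iff_norm_le_pow_sub_one] at h1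
    have h2 : -((n : ℚ_[p]) * (p : ℚ_[p]) ^ (-(k + 1))) + x =
        (x * (p : ℚ_[p]) ^ (k + 1) - n) * (p : ℚ_[p]) ^ (-(k + 1)) := by
      rw [zpow_neg]
      field_simp
      ring
    simp only
    rw [h2, norm_mul, Padic.norm_p_zpow, neg_neg]
    calc _ ≤ (p : ℝ) ^ ((0 : ℤ) - 1) * (p : ℝ) ^ (k + 1) := by gcongr
      _ = _ := by rw [← zpow_add₀ hp0.ne']; congr 1; ring
  · rintro ⟨i, hi⟩
    have h2 : x = ((i : ℕ) * (p : ℚ_[p]) ^ (-(k + 1))) +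
      (-((i : ℕ) * (p : ℚ_[p]) ^ (-(k + 1))) + x) := by ring
    rw [h2]
    refine (Padic.nonarchimedean _ _).trans (max_le ?_ (hi.trans ?_))
    · rw [norm_mul, Padic.norm_p_zpow, neg_neg]
      have : ‖((i : ℕ) : ℚ_[p])‖ ≤ 1 := by exact_mod_cast Padic.norm_int_le_one (p := p) (i : ℕ)
      exact mul_le_of_le_one_left (by positivity) this
    · exact zpow_le_zpow_right₀ hp1 (by lia)

lemma padic_ball_translates_disjoint (k : ℤ) :
    Pairwise (Function.onFun Disjoint fun i : Fin p =>
      (fun x => -((i : ℕ) * (p : ℚ_[p]) ^ (-(k + 1))) + x) ⁻¹'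
        {x : ℚ_[p] | ‖x‖ ≤ (p : ℝ) ^ k}) := by
  have hp0 : (0 : ℝ) < p := by exact_mod_cast (Fact.out : p.Prime).pos
  have hp1 : (1 : ℝ) < p := by exact_mod_cast (Fact.out : p.Prime).one_lt
  intro i j hij
  rw [Function.onFun, Set.disjoint_left]
  intro x hi hj
  simp only [Set.mem_preimage, Set.mem_ofPred_eq] at hi hj
  apply hij
  have h1 : ‖((((i : ℕ) : ℤ) - ((j : ℕ) : ℤ) : ℤ) : ℚ_[p]) * (p : ℚ_[p]) ^ (-(k + 1))‖
      ≤ (p : ℝ) ^ k := by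
    have h2 : ((((i : ℕ) : ℤ) - ((j : ℕ) : ℤ) : ℤ) : ℚ_[p]) * (p : ℚ_[p]) ^ (-(k + 1)) =
      (-((j : ℕ) * (p : ℚ_[p]) ^ (-(k + 1))) + x) -
      (-((i : ℕ) * (p : ℚ_[p]) ^ (-(k + 1))) + x) := by
      push_cast
      ring
    rw [h2, sub_eq_add_neg]
    refine (Padic.nonarchimedean _ _).trans (max_le hj ?_)
    rwa [norm_neg]
  rw [norm_mul, Padic.norm_p_zpow, neg_neg] at h1
  have h3 : ‖((((i : ℕ) : ℤ) - ((j : ℕ) : ℤ) : ℤ) : ℚ_[p])‖ < 1 := by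
    by_contra! h
    have h4 : (p : ℝ) ^ k < (p : ℝ) ^ (k + 1) := zpow_lt_zpow_right₀ hp1 (by lia)
    have h5 : (p : ℝ) ^ (k + 1) ≤ ‖((((i : ℕ) : ℤ) - ((j : ℕ) : ℤ) : ℤ) : ℚ_[p])‖ *
      (p : ℝ) ^ (k + 1) := le_mul_of_one_le_left (by positivity) h
    linarith
  rw [Padic.norm_intCast_lt_one_iff] at h3
  have hi' := i.isLt
  have hj' := j.isLt
  have h4 := Int.eq_zero_of_abs_lt_dvd h3 (by rw [abs_lt]; constructor <;> omega)
  exact Fin.ext (by lia)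

/-- The profile `‖z‖ ^ (-t)` on the unit ball, `‖z‖ ^ (t - 2)` outside. -/
noncomputable def padicProfile (p : ℕ) [Fact p.Prime] (t : ℝ) (z : ℚ_[p]) : ℝ :=
  if ‖z‖ ≤ 1 then ‖z‖ ^ (-t) else ‖z‖ ^ (t - 2)

lemma padicProfile_nonneg (t : ℝ) (z : ℚ_[p]) : 0 ≤ padicProfile p t z := by
  unfold padicProfile
  split_ifs <;> positivity

lemma ofReal_padicProfile_le {t : ℝ} (ht : 0 < t) (z : ℚ_[p]) :
    ENNReal.ofReal (padicProfile p t z) ≤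
      ∑' k : ℕ, ({x : ℚ_[p] | ‖x‖ ≤ (p : ℝ) ^ (-(k : ℤ))}.indicator
        (fun _ => ENNReal.ofReal ((p : ℝ) ^ (t * k))) z +
      {x : ℚ_[p] | ‖x‖ ≤ (p : ℝ) ^ (k : ℤ)}.indicator
        (fun _ => ENNReal.ofReal ((p : ℝ) ^ ((t - 2) * k))) z) := by
  have hp0 : (0 : ℝ) < p := by exact_mod_cast (Fact.out : p.Prime).pos
  have hp1 : (1 : ℝ) < p := by exact_mod_cast (Fact.out : p.Prime).one_lt
  rcases eq_or_ne z 0 with rfl | hz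
  · simp [padicProfile, Real.zero_rpow (neg_ne_zero.2 ht.ne')]
  obtain ⟨m, hm⟩ : ∃ m : ℤ, ‖z‖ = (p : ℝ) ^ m := ⟨_, Padic.norm_eq_zpow_neg_valuation hz⟩
  unfold padicProfile
  split_ifs with h
  · have hm0 : m ≤ 0 := by
      rw [hm] at h
      by_contra! h'
      exact absurd h (not_le.2 (one_lt_zpow₀ hp1 h'))
    obtain ⟨k, rfl⟩ : ∃ k : ℕ, m = -(k : ℤ) := ⟨m.natAbs, by lia⟩
    refine le_trans ?_ (ENNReal.le_tsum k)
    refine le_trans ?_ le_self_add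
    rw [Set.indicator_of_mem (by simp [hm]), hm]
    refine ENNReal.ofReal_le_ofReal (le_of_eq ?_)
    rw [← Real.rpow_intCast, ← Real.rpow_mul hp0.le]
    congr 1
    push_cast
    ring
  · have hm0 : 0 ≤ m := by
      rw [hm] at h
      by_contra! h'
      exact h (zpow_le_one_of_nonpos₀ hp1.le h'.le)
    obtain ⟨k, rfl⟩ : ∃ k : ℕ, m = (k : ℤ) := ⟨m.natAbs, by lia⟩
    refine le_trans ?_ (ENNReal.le_tsum k)
    refine le_trans ?_ le_add_self
    rw [Set.indicator_of_mem (by simp [hm]), hm]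
    refine ENNReal.ofReal_le_ofReal (le_of_eq ?_)
    rw [← Real.rpow_intCast, ← Real.rpow_mul hp0.le]
    congr 1
    push_cast
    ring

/-- The sum of translates of the profile which bounds the dependence on the last variable. -/
noncomputable def padicMajorant {n : ℕ} (t : ℝ) (x : Fin n → ℚ_[p]) (j : Fin n) : ℝ :=
  2 * padicProfile p t (x j) + padicProfile p t (x j - 1) +
    ∑ i, if i < j then padicProfile p t (x j - x i) else 0

lemma padicMajorant_nonneg {n : ℕ} (t : ℝ) (x : Fin n → ℚ_[p]) (j : Fin n) :
    0 ≤ padicMajorant t x j := by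
  have h := padicProfile_nonneg (p := p) t
  refine add_nonneg (add_nonneg (mul_nonneg two_pos.le (h _)) (h _)) (sum_nonneg fun i _ => ?_)
  split_ifs
  · exact h _
  · exact le_rfl

lemma padicMajorant_snoc_castSucc {n : ℕ} (t : ℝ) (x : Fin n → ℚ_[p]) (z : ℚ_[p]) (j : Fin n) :
    padicMajorant t (Fin.snoc x z : Fin (n + 1) → ℚ_[p]) j.castSucc = padicMajorant t x j := by
  simp [padicMajorant, Fin.sum_univ_castSucc, (Fin.castSucc_lt_last j).not_gt]

lemma padicMajorant_snoc_last {n : ℕ} (t : ℝ) (x : Fin n → ℚ_[p]) (z : ℚ_[p]) :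
    padicMajorant t (Fin.snoc x z : Fin (n + 1) → ℚ_[p]) (Fin.last n) =
      2 * padicProfile p t z + padicProfile p t (z - 1) + ∑ i, padicProfile p t (z - x i) := by
  simp [padicMajorant, Fin.sum_univ_castSucc, Fin.castSucc_lt_last]

variable [MeasurableSpace ℚ_[p]] [BorelSpace ℚ_[p]] (μ : Measure ℚ_[p]) [μ.IsAddHaarMeasure]

lemma padic_measurableSet_ball (r : ℝ) : MeasurableSet {x : ℚ_[p] | ‖x‖ ≤ r} :=
  measurableSet_le continuous_norm.measurable measurable_const

lemma padic_measure_ball_succ (k : ℤ) :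
    μ {x : ℚ_[p] | ‖x‖ ≤ (p : ℝ) ^ (k + 1)} = p * μ {x : ℚ_[p] | ‖x‖ ≤ (p : ℝ) ^ k} := by
  rw [padic_ball_succ_eq_iUnion, measure_iUnion (padic_ball_translates_disjoint k)
    fun i => (measurable_const_add _) (padic_measurableSet_ball _)]
  simp only [measure_preimage_add, tsum_fintype, Finset.sum_const, Finset.card_univ,
    Fintype.card_fin, nsmul_eq_mul]

lemma padic_measure_ball (hμ : μ {x : ℚ_[p] | ‖x‖ ≤ 1} = 1) (k : ℤ) :
    μ {x : ℚ_[p] | ‖x‖ ≤ (p : ℝ) ^ k} = ENNReal.ofReal ((p : ℝ) ^ k) := by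
  have hp0 : (0 : ℝ) < p := by exact_mod_cast (Fact.out : p.Prime).pos
  have hpe : (p : ENNReal) ≠ 0 := by exact_mod_cast (Fact.out : p.Prime).ne_zero
  have hp : ENNReal.ofReal (p : ℝ) = p := ENNReal.ofReal_natCast p
  have key : ∀ k : ℤ, ENNReal.ofReal ((p : ℝ) ^ (k + 1)) = p * ENNReal.ofReal ((p : ℝ) ^ k) := by
    intro k
    rw [zpow_add_one₀ hp0.ne', ENNReal.ofReal_mul (by positivity), hp, mul_comm]
  induction k using Int.induction_on with
  | zero => simpa using hμ
  | succ k ih => rw [padic_measure_ball_succ, key, ih]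
  | pred k ih =>
    have h1 := padic_measure_ball_succ μ (-(k : ℤ) - 1)
    have h2 := key (-(k : ℤ) - 1)
    rw [sub_add_cancel] at h1 h2
    rw [ih, h2] at h1
    exact ((ENNReal.mul_right_inj hpe (ENNReal.natCast_ne_top p)).1 h1).symm

lemma measurable_padicProfile (t : ℝ) : Measurable (padicProfile p t) := by
  unfold padicProfile
  exact Measurable.ite (padic_measurableSet_ball 1) (continuous_norm.measurable.pow_const _)
    (continuous_norm.measurable.pow_const _)

lemma lintegral_padicProfile_lt_top (hμ : μ {x : ℚ_[p] | ‖x‖ ≤ 1} = 1) {t : ℝ} (ht : 0 < t)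
    (ht1 : t < 1) : ∫⁻ z, ENNReal.ofReal (padicProfile p t z) ∂μ < ⊤ := by
  have hp0 : (0 : ℝ) < p := by exact_mod_cast (Fact.out : p.Prime).pos
  have hp1 : (1 : ℝ) < p := by exact_mod_cast (Fact.out : p.Prime).one_lt
  refine (lintegral_mono (ofReal_padicProfile_le ht)).trans_lt ?_
  rw [lintegral_tsum fun k => Measurable.aemeasurable <| Measurable.fun_add
    (measurable_const.indicator (padic_measurableSet_ball _))
    (measurable_const.indicator (padic_measurableSet_ball _))]
  have h : ∀ k : ℕ, ∫⁻ z, ({x : ℚ_[p] | ‖x‖ ≤ (p : ℝ) ^ (-(k : ℤ))}.indicator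
        (fun _ => ENNReal.ofReal ((p : ℝ) ^ (t * k))) z +
      {x : ℚ_[p] | ‖x‖ ≤ (p : ℝ) ^ (k : ℤ)}.indicator
        (fun _ => ENNReal.ofReal ((p : ℝ) ^ ((t - 2) * k))) z) ∂μ =
      2 * ENNReal.ofReal ((p : ℝ) ^ (t - 1)) ^ k := by
    intro k
    rw [lintegral_add_left (measurable_const.indicator (padic_measurableSet_ball _)),
      lintegral_indicator_const (padic_measurableSet_ball _),
      lintegral_indicator_const (padic_measurableSet_ball _), padic_measure_ball μ hμ,
      padic_measure_ball μ hμ, ← ENNReal.ofReal_mul (by positivity),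
      ← ENNReal.ofReal_mul (by positivity), two_mul, ← ENNReal.ofReal_pow (by positivity),
      ← Real.rpow_intCast, ← Real.rpow_intCast, ← Real.rpow_add hp0, ← Real.rpow_add hp0,
      ← Real.rpow_mul_natCast hp0.le]
    congr 4 <;> push_cast <;> ring
  simp_rw [h]
  rw [ENNReal.tsum_mul_left, ENNReal.tsum_geometric]
  refine ENNReal.mul_lt_top (by simp) ?_
  rw [ENNReal.inv_lt_top, tsub_pos_iff_lt, ENNReal.ofReal_lt_one]
  exact Real.rpow_lt_one_of_one_lt_of_neg hp1 (by linarith)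

lemma measurable_padicMajorant {n : ℕ} (t : ℝ) (j : Fin n) :
    Measurable fun x : Fin n → ℚ_[p] => padicMajorant t x j := by
  have h := measurable_padicProfile (p := p) t
  unfold padicMajorant
  refine ((((h.comp (measurable_pi_apply j)).const_mul 2).add
    (h.comp ((measurable_pi_apply j).sub_const 1))).add
    (Finset.measurable_fun_sum _ fun i _ => ?_))
  split_ifs
  · exact h.comp ((measurable_pi_apply j).sub (measurable_pi_apply i))
  · exact measurable_const

lemma lintegral_last_padicMajorant (t : ℝ) {n : ℕ} (x : Fin n → ℚ_[p]) :
    ∫⁻ z, ENNReal.ofReal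
      (padicMajorant t (Fin.snoc x z : Fin (n + 1) → ℚ_[p]) (Fin.last n)) ∂μ =
      (n + 3) * ∫⁻ z, ENNReal.ofReal (padicProfile p t z) ∂μ := by
  have h := measurable_padicProfile (p := p) t
  have h0 := padicProfile_nonneg (p := p) t
  have hs : ∀ v, ∫⁻ z, ENNReal.ofReal (padicProfile p t (z - v)) ∂μ =
      ∫⁻ z, ENNReal.ofReal (padicProfile p t z) ∂μ := fun v =>
    lintegral_sub_right_eq_self (fun z => ENNReal.ofReal (padicProfile p t z)) v
  have hm : ∀ v, Measurable fun z => ENNReal.ofReal (padicProfile p t (z - v)) := fun v =>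
    (h.comp (measurable_id.sub_const v)).ennreal_ofReal
  have e : ∀ z, ENNReal.ofReal
      (padicMajorant t (Fin.snoc x z : Fin (n + 1) → ℚ_[p]) (Fin.last n)) =
      2 * ENNReal.ofReal (padicProfile p t z) + ENNReal.ofReal (padicProfile p t (z - 1)) +
        ∑ i, ENNReal.ofReal (padicProfile p t (z - x i)) := by
    intro z
    rw [padicMajorant_snoc_last, ENNReal.ofReal_add (by have := h0 z; have := h0 (z - 1); linarith)
      (sum_nonneg fun i _ => h0 _), ENNReal.ofReal_add (by have := h0 z; linarith) (h0 _),
      ENNReal.ofReal_mul two_pos.le, ENNReal.ofReal_sum_of_nonneg fun i _ => h0 _]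
    simp
  simp_rw [e]
  rw [lintegral_add_right _ (Finset.measurable_fun_sum _ fun i _ => hm _),
    lintegral_add_right _ (hm _), lintegral_const_mul _ h.ennreal_ofReal,
    lintegral_finsetSum _ fun i _ => hm _]
  simp_rw [hs]
  rw [sum_const, card_univ, Fintype.card_fin, nsmul_eq_mul]
  ring

lemma lintegral_prod_padicMajorant_lt_top [SigmaFinite μ] (hμ : μ {x : ℚ_[p] | ‖x‖ ≤ 1} = 1)
    {t : ℝ} (ht : 0 < t) (ht1 : t < 1) (n : ℕ) :
    ∫⁻ x : Fin n → ℚ_[p], ENNReal.ofReal (∏ j, padicMajorant t x j)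
      ∂(Measure.pi fun _ => μ) < ⊤ := by
  induction n with
  | zero => simp
  | succ n ih =>
    have hmp := (measurePreserving_piFinSuccAbove (fun _ : Fin (n + 1) => μ) (Fin.last n)).symm
    rw [← hmp.lintegral_comp_emb (MeasurableEquiv.measurableEmbedding _), lintegral_prod_symm]
    · have e : ∀ (y : Fin n → ℚ_[p]) (z : ℚ_[p]), ENNReal.ofReal (∏ j, padicMajorant t
          ((MeasurableEquiv.piFinSuccAbove (fun _ : Fin (n + 1) => ℚ_[p])
            (Fin.last n)).symm (z, y)) j) =
          ENNReal.ofReal (∏ j, padicMajorant t y j) * ENNReal.ofReal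
            (padicMajorant t (Fin.snoc y z : Fin (n + 1) → ℚ_[p]) (Fin.last n)) := by
        intro y z
        have hsnoc : (MeasurableEquiv.piFinSuccAbove (fun _ : Fin (n + 1) => ℚ_[p])
            (Fin.last n)).symm (z, y) = (Fin.snoc y z : Fin (n + 1) → ℚ_[p]) :=
          Fin.insertNth_last' z y
        rw [← ENNReal.ofReal_mul (prod_nonneg fun j _ => padicMajorant_nonneg _ _ _),
          hsnoc, Fin.prod_univ_castSucc]
        simp only [padicMajorant_snoc_castSucc]
      simp_rw [e]
      have hm : Measurable fun y : Fin n → ℚ_[p] =>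
          ENNReal.ofReal (∏ j, padicMajorant t y j) :=
        (Finset.measurable_fun_prod _ fun j _ => measurable_padicMajorant t j).ennreal_ofReal
      calc _ = ∫⁻ y : Fin n → ℚ_[p], ENNReal.ofReal (∏ j, padicMajorant t y j) *
            ((n + 3) * ∫⁻ z, ENNReal.ofReal (padicProfile p t z) ∂μ)
            ∂(Measure.pi fun _ => μ) := by
            refine lintegral_congr fun y => ?_
            rw [lintegral_const_mul' _ _ ENNReal.ofReal_ne_top, lintegral_last_padicMajorant]
        _ = _ := lintegral_mul_const _ hm
        _ < ⊤ := ENNReal.mul_lt_top ih (ENNReal.mul_lt_top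
            (ENNReal.add_lt_top.2 ⟨ENNReal.natCast_lt_top n, by simp⟩)
            (lintegral_padicProfile_lt_top μ hμ ht ht1))
    · exact (((Finset.measurable_fun_prod _ fun j _ => measurable_padicMajorant t j).comp
        (MeasurableEquiv.measurable _)).ennreal_ofReal).aemeasurable

end Measure

section Combinatorics

/-- The contribution of one level set of an ultrametric valuation `h`: the relation `l < h u v`
partitions `V` into classes, on each of which the total weight is controlled. -/
lemma sum_ite_lt_le_of_ultrametric {V : Type*} [Fintype V] [LinearOrder V] {h : V → V → ℕ}
    {W : V → V → ℝ} {M : V → ℕ} {t : ℝ} (ht : 0 ≤ t) (hsymm : ∀ u v, h u v = h v u)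
    (hult : ∀ u v w, u ≠ w → min (h u v) (h v w) ≤ h u w) (hM : ∀ u v, u < v → h u v ≤ M v)
    (hW0 : ∀ u, W u u = 0)
    (hW : ∀ S : Finset V, S.Nonempty → (∀ u ∈ S, ∀ v ∈ S, u ≠ v → 0 < h u v) →
      ∑ u ∈ S, ∑ v ∈ S, W u v ≤ 2 * t * (#S - 1)) (l : ℕ) :
    ∑ u, ∑ v, (if l < h u v then W u v else 0) ≤ 2 * t * ∑ v, if l < M v then (1 : ℝ) else 0 := by
  classical
  let R : V → V → Prop := fun u v => u = v ∨ l < h u v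
  have hRs : ∀ {u v}, R u v → R v u := by
    rintro u v (h1 | h1)
    · exact Or.inl h1.symm
    · exact Or.inr (hsymm u v ▸ h1)
  have hRt : ∀ {u v w}, R u v → R v w → R u w := by
    rintro u v w (rfl | h1) (rfl | h2)
    · exact Or.inl rfl
    · exact Or.inr h2
    · exact Or.inr h1
    · by_cases huw : u = w
      · exact Or.inl huw
      · exact Or.inr ((lt_min h1 h2).trans_le (hult u v w huw))
  have hne : ∀ v, (univ.filter fun u => R u v).Nonempty := fun v => ⟨v, by simp [R]⟩
  let m : V → V := fun v => (univ.filter fun u => R u v).min' (hne v)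
  have hmR : ∀ v, R (m v) v := fun v => (mem_filter.1 (min'_mem _ (hne v))).2
  have hmle : ∀ {u v}, R u v → m v ≤ u := fun huv => min'_le _ _ (by simpa using huv)
  have hiff : ∀ u v, m u = m v ↔ R u v := by
    refine fun u v => ⟨fun h1 => hRt (hRs (hmR u)) (h1 ▸ hmR v), fun h1 => ?_⟩
    exact le_antisymm (hmle (hRt (hmR v) (hRs h1))) (hmle (hRt (hmR u) h1))
  have e1 : ∑ u, ∑ v, (if l < h u v then W u v else 0) =
      ∑ c ∈ univ.image m, ∑ u with m u = c, ∑ v with m v = c, W u v := by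
    rw [← sum_fiberwise_of_maps_to (s := univ) (t := univ.image m) (g := m)
      fun u _ => mem_image_of_mem m (mem_univ u)]
    refine sum_congr rfl fun c _ => sum_congr rfl fun u hu => ?_
    rw [sum_filter]
    refine sum_congr rfl fun v _ => ?_
    have h1 : m v = c ↔ R u v := by
      rw [← (mem_filter.1 hu).2, eq_comm, hiff]
    by_cases huv : u = v
    · subst huv
      simp [hW0]
    · simp [h1, R, huv]
  have e2 : ∀ c ∈ univ.image m, ∑ u with m u = c, ∑ v with m v = c, W u v ≤
      2 * t * ((#{u | m u = c} : ℝ) - 1) := by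
    intro c hc
    obtain ⟨v, -, rfl⟩ := mem_image.1 hc
    refine hW _ ⟨v, by simp⟩ fun u hu w hw huw => ?_
    have h1 : R u w := (hiff u w).1 ((mem_filter.1 hu).2.trans (mem_filter.1 hw).2.symm)
    exact (Nat.zero_le l).trans_lt (h1.resolve_left huw)
  have e3 : ∑ c ∈ univ.image m, (#{u | m u = c} : ℝ) = Fintype.card V := by
    rw [← Finset.card_univ, card_eq_sum_card_image m univ]
    push_cast
    rfl
  have e4 : (Fintype.card V : ℝ) ≤ #(univ.image m) + #{v | l < M v} := by
    have h1 : (univ : Finset V) ⊆ univ.image m ∪ ({v | l < M v} : Finset V) := by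
      intro v _
      by_cases hv : m v = v
      · exact mem_union_left _ (mem_image.2 ⟨v, mem_univ v, hv⟩)
      · refine mem_union_right _ (mem_filter.2 ⟨mem_univ v, ?_⟩)
        exact ((hmR v).resolve_left hv).trans_le
          (hM _ _ (lt_of_le_of_ne (hmle (Or.inl rfl)) hv))
    exact_mod_cast (card_le_card h1).trans (card_union_le _ _)
  rw [e1, sum_boole]
  calc _ ≤ ∑ c ∈ univ.image m, 2 * t * ((#{u | m u = c} : ℝ) - 1) := sum_le_sum e2
    _ = 2 * t * (Fintype.card V - #(univ.image m)) := by
      rw [← mul_sum, sum_sub_distrib, e3, sum_const, nsmul_one]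
    _ ≤ _ := by
      gcongr
      linarith

lemma sum_mul_le_of_ultrametric {V : Type*} [Fintype V] [LinearOrder V] {h : V → V → ℕ}
    {W : V → V → ℝ} {M : V → ℕ} {t : ℝ} (ht : 0 ≤ t) (hsymm : ∀ u v, h u v = h v u)
    (hult : ∀ u v w, u ≠ w → min (h u v) (h v w) ≤ h u w) (hM : ∀ u v, u < v → h u v ≤ M v)
    (hW0 : ∀ u, W u u = 0)
    (hW : ∀ S : Finset V, S.Nonempty → (∀ u ∈ S, ∀ v ∈ S, u ≠ v → 0 < h u v) →
      ∑ u ∈ S, ∑ v ∈ S, W u v ≤ 2 * t * (#S - 1)) :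
    ∑ u, ∑ v, W u v * h u v ≤ 2 * t * ∑ v, (M v : ℝ) := by
  obtain ⟨L, hL, hL'⟩ : ∃ L : ℕ, (∀ u v, h u v ≤ L) ∧ ∀ v, M v ≤ L := by
    refine ⟨∑ u, ∑ v, h u v + ∑ v, M v, fun u v => ?_, fun v => ?_⟩
    · exact ((single_le_sum_of_canonicallyOrdered (mem_univ v)).trans
        (single_le_sum_of_canonicallyOrdered (f := fun u => ∑ v, h u v) (mem_univ u))).trans
        (Nat.le_add_right _ _)
    · exact (single_le_sum_of_canonicallyOrdered (mem_univ v)).trans (Nat.le_add_left _ _)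
  have hlayer : ∀ k : ℕ, k ≤ L → (k : ℝ) = ∑ l ∈ range L, if l < k then (1 : ℝ) else 0 := by
    intro k hk
    rw [sum_boole]
    congr 1
    have : (range L).filter (· < k) = range k := by
      ext l
      simp only [mem_filter, mem_range]
      lia
    rw [this, card_range]
  calc ∑ u, ∑ v, W u v * h u v
      = ∑ u, ∑ v, ∑ l ∈ range L, if l < h u v then W u v else 0 := by
        refine sum_congr rfl fun u _ => sum_congr rfl fun v _ => ?_
        rw [hlayer _ (hL u v), mul_sum]
        simp
    _ = ∑ l ∈ range L, ∑ u, ∑ v, if l < h u v then W u v else 0 := by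
        rw [sum_comm]
        simp_rw [fun v => sum_comm (s := univ) (t := range L) (f := fun u l =>
          if l < h u v then W u v else 0)]
        rw [sum_comm]
        exact sum_congr rfl fun l _ => sum_comm
    _ ≤ ∑ l ∈ range L, 2 * t * ∑ v, if l < M v then (1 : ℝ) else 0 :=
        sum_le_sum fun l _ => sum_ite_lt_le_of_ultrametric ht hsymm hult hM hW0 hW l
    _ = _ := by
        rw [← mul_sum, sum_comm]
        congr 1
        exact sum_congr rfl fun v _ => (hlayer _ (hL' v)).symm

/-- The weights on the pairs of points `∞, 0, 1, x_0, …, x_{n-1}`: `E` weighs the pairs of a fixed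
point and a variable, `C` the pairs of variables. -/
def pointWeight {n : ℕ} (E : Fin 3 → Fin n → ℝ) (C : Fin n → Fin n → ℝ) :
    Fin 3 ⊕ Fin n → Fin 3 ⊕ Fin n → ℝ
  | .inl _, .inl _ => 0
  | .inl i, .inr j => E i j
  | .inr j, .inl i => E i j
  | .inr i, .inr j => C i j

section Weights

variable {n : ℕ} {E : Fin 3 → Fin n → ℝ} {C : Fin n → Fin n → ℝ}

lemma pointWeight_self (hC0 : ∀ j, C j j = 0) (u : Fin 3 ⊕ Fin n) : pointWeight E C u u = 0 := by
  rcases u with i | j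
  · rfl
  · exact hC0 j

lemma sum_pointWeight_lt_of_infty_mem (hC0 : ∀ j, C j j = 0)
    (hC : ∀ i j, i ≠ j → 2 / ((n : ℝ) + 3) < C i j)
    (h1 : ∀ j, 2 / ((n : ℝ) + 3) < E 1 j) (h2 : ∀ j, 2 / ((n : ℝ) + 3) < E 2 j)
    (h0 : ∀ j, E 0 j = 2 - E 1 j - E 2 j - ∑ i, C i j)
    {S : Finset (Fin 3 ⊕ Fin n)} (hL : S.toLeft = {0}) (hS : 2 ≤ #S) :
    ∑ u ∈ S, ∑ v ∈ S, pointWeight E C u v < 2 * (#S - 1) := by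
  have hn : (0 : ℝ) < n + 3 := by positivity
  have hnn : ∀ i j, 0 ≤ C i j := by
    intro i j
    by_cases hij : i = j
    · rw [hij, hC0]
    · exact (by positivity : (0 : ℝ) ≤ 2 / ((n : ℝ) + 3)).trans (hC i j hij).le
  have hcard : #S = 1 + #S.toRight := by
    rw [← card_toLeft_add_card_toRight, hL, card_singleton]
  have hne : S.toRight.Nonempty := card_pos.1 (by lia)
  have hsum : ∀ f : Fin 3 ⊕ Fin n → ℝ, ∑ u ∈ S, f u = f (.inl 0) + ∑ j ∈ S.toRight, f (.inr j) := by
    intro f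
    conv_lhs => rw [← toLeft_disjSum_toRight (u := S), sum_disjSum, hL, sum_singleton]
  have hrow : ∀ j ∈ S.toRight, 2 * E 0 j + ∑ i ∈ S.toRight, C i j < 2 := by
    intro j _
    have ha : ∑ i ∈ S.toRight, C i j ≤ ∑ i, C i j :=
      sum_le_sum_of_subset_of_nonneg (subset_univ _) fun i _ _ => hnn i j
    have hb : ((n : ℝ) - 1) * (2 / ((n : ℝ) + 3)) ≤ ∑ i, C i j := by
      rw [← sum_erase univ (f := fun i => C i j) (a := j) (hC0 j)]
      have := card_nsmul_le_sum (univ.erase j) (fun i => C i j) (2 / ((n : ℝ) + 3))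
        fun i hi => (hC i j (ne_of_mem_erase hi)).le
      rw [card_erase_of_mem (mem_univ j), card_univ, Fintype.card_fin, nsmul_eq_mul,
        Nat.cast_pred (j.pos)] at this
      exact this
    have hc : ((n : ℝ) - 1) * (2 / ((n : ℝ) + 3)) + 4 * (2 / ((n : ℝ) + 3)) = 2 := by
      field_simp
      ring
    have := h1 j
    have := h2 j
    rw [h0 j]
    linarith
  calc ∑ u ∈ S, ∑ v ∈ S, pointWeight E C u v
      = ∑ j ∈ S.toRight, (2 * E 0 j + ∑ i ∈ S.toRight, C i j) := by
        rw [hsum]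
        simp_rw [hsum, pointWeight]
        rw [sum_add_distrib, sum_add_distrib, ← mul_sum,
          sum_comm (s := S.toRight) (t := S.toRight)]
        ring
    _ < ∑ j ∈ S.toRight, 2 := sum_lt_sum_of_nonempty hne hrow
    _ = _ := by
        rw [sum_const, hcard, nsmul_eq_mul]
        push_cast
        ring

lemma sum_pointWeight_lt_of_infty_notMem (hC0 : ∀ j, C j j = 0)
    (hC : ∀ i j, i ≠ j → C i j < 2 / ((n : ℝ) + 1))
    (h1 : ∀ j, E 1 j < 2 / ((n : ℝ) + 1)) (h2 : ∀ j, E 2 j < 2 / ((n : ℝ) + 1))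
    {S : Finset (Fin 3 ⊕ Fin n)} (hL : #S.toLeft ≤ 1) (hL0 : .inl 0 ∉ S) (hS : 2 ≤ #S) :
    ∑ u ∈ S, ∑ v ∈ S, pointWeight E C u v < 2 * (#S - 1) := by
  have hn : (0 : ℝ) < n + 1 := by positivity
  have hcard : (#S : ℝ) ≤ n + 1 := by
    have h3 : #S.toRight ≤ n := by simpa using card_le_univ S.toRight
    have h4 := card_toLeft_add_card_toRight (u := S)
    exact_mod_cast (by lia : #S ≤ n + 1)
  have hS' : (2 : ℝ) ≤ #S := by exact_mod_cast hS
  have hE : ∀ i j, .inl i ∈ S → E i j < 2 / ((n : ℝ) + 1) := by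
    intro i j hi
    fin_cases i
    · exact absurd hi hL0
    · exact h1 j
    · exact h2 j
  have hpair : ∀ u ∈ S, ∀ v ∈ S, u ≠ v → pointWeight E C u v < 2 / ((n : ℝ) + 1) := by
    rintro (i | i) hu (j | j) hv huv
    · exact (by positivity : (0 : ℝ) < 2 / ((n : ℝ) + 1))
    · exact hE i j hu
    · exact hE j i hv
    · exact hC i j fun h => huv (congrArg _ h)
  have hrow : ∀ u ∈ S, ∑ v ∈ S, pointWeight E C u v < (#S - 1) * (2 / ((n : ℝ) + 1)) := by
    intro u hu
    rw [← sum_erase S (a := u) (pointWeight_self hC0 u)]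
    have hne : (S.erase u).Nonempty := card_pos.1 (by rw [card_erase_of_mem hu]; lia)
    have := sum_lt_sum_of_nonempty hne fun v hv =>
      hpair u hu v (mem_of_mem_erase hv) (ne_of_mem_erase hv).symm
    rwa [sum_const, card_erase_of_mem hu, nsmul_eq_mul, Nat.cast_pred (by lia)] at this
  calc ∑ u ∈ S, ∑ v ∈ S, pointWeight E C u v < ∑ u ∈ S, (#S - 1) * (2 / ((n : ℝ) + 1)) :=
        sum_lt_sum_of_nonempty (card_pos.1 (by lia)) hrow
    _ = 2 * (#S - 1) * (#S / (n + 1)) := by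
        rw [sum_const, nsmul_eq_mul]
        ring
    _ ≤ 2 * (#S - 1) * 1 := by
        gcongr
        · linarith
        · rwa [div_le_one hn]
    _ = _ := mul_one _

lemma exists_lt_one_sum_pointWeight_le (hC0 : ∀ j, C j j = 0)
    (hC : ∀ i j, i ≠ j → 2 / ((n : ℝ) + 3) < C i j ∧ C i j < 2 / ((n : ℝ) + 1))
    (h1 : ∀ j, 2 / ((n : ℝ) + 3) < E 1 j ∧ E 1 j < 2 / ((n : ℝ) + 1))
    (h2 : ∀ j, 2 / ((n : ℝ) + 3) < E 2 j ∧ E 2 j < 2 / ((n : ℝ) + 1))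
    (h0 : ∀ j, E 0 j = 2 - E 1 j - E 2 j - ∑ i, C i j) :
    ∃ t : ℝ, 0 < t ∧ t < 1 ∧ ∀ S : Finset (Fin 3 ⊕ Fin n), S.Nonempty →
      (∀ i j : Fin 3, .inl i ∈ S → .inl j ∈ S → i = j) →
      ∑ u ∈ S, ∑ v ∈ S, pointWeight E C u v ≤ 2 * t * (#S - 1) := by
  have hall : ∀ S : Finset (Fin 3 ⊕ Fin n), ∀ᶠ t : ℝ in nhdsWithin 1 (Set.Iio 1), S.Nonempty →
      (∀ i j : Fin 3, .inl i ∈ S → .inl j ∈ S → i = j) →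
      ∑ u ∈ S, ∑ v ∈ S, pointWeight E C u v ≤ 2 * t * (#S - 1) := by
    intro S
    by_cases hS : S.Nonempty ∧ ∀ i j : Fin 3, .inl i ∈ S → .inl j ∈ S → i = j
    swap
    · exact Filter.Eventually.of_forall fun t h h' => absurd ⟨h, h'⟩ hS
    obtain ⟨hne, hfix⟩ := hS
    rcases Nat.lt_or_ge #S 2 with hcard | hcard
    · have : #S = 1 := by have := card_pos.2 hne; lia
      obtain ⟨u, rfl⟩ := card_eq_one.1 this
      refine Filter.Eventually.of_forall fun t _ _ => ?_
      simp [pointWeight_self hC0]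
    have hL : #S.toLeft ≤ 1 := card_le_one.2 fun i hi j hj =>
      hfix i j (mem_toLeft.1 hi) (mem_toLeft.1 hj)
    have hlt : ∑ u ∈ S, ∑ v ∈ S, pointWeight E C u v < 2 * (#S - 1) := by
      by_cases hL0 : .inl 0 ∈ S
      · refine sum_pointWeight_lt_of_infty_mem hC0 (fun i j h => (hC i j h).1)
          (fun j => (h1 j).1) (fun j => (h2 j).1) h0 ?_ hcard
        exact eq_singleton_iff_unique_mem.2 ⟨mem_toLeft.2 hL0, fun i hi =>
          hfix i 0 (mem_toLeft.1 hi) hL0⟩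
      · exact sum_pointWeight_lt_of_infty_notMem hC0 (fun i j h => (hC i j h).2)
          (fun j => (h1 j).2) (fun j => (h2 j).2) hL hL0 hcard
    have htend : Filter.Tendsto (fun t : ℝ => 2 * t * ((#S : ℝ) - 1)) (nhdsWithin 1 (Set.Iio 1))
        (nhds (2 * (#S - 1))) := by
      have hcont : Continuous fun t : ℝ => 2 * t * ((#S : ℝ) - 1) := by fun_prop
      simpa using (hcont.tendsto 1).mono_left nhdsWithin_le_nhds
    filter_upwards [htend.eventually_const_lt hlt] with t ht _ _ using ht.le
  have hpos : ∀ᶠ t : ℝ in nhdsWithin 1 (Set.Iio 1), 0 < t :=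
    (eventually_gt_nhds one_pos).filter_mono nhdsWithin_le_nhds
  obtain ⟨t, ht, ht0, ht1⟩ := ((Filter.eventually_all.2 hall).and
    (hpos.and (eventually_mem_nhdsWithin (a := (1 : ℝ)) (s := Set.Iio 1)))).exists
  exact ⟨t, ht0, ht1, ht⟩

end Weights

end Combinatorics

section Chordal

variable {p : ℕ} [Fact p.Prime]

/-- The chordal distance on the projective line over `ℚ_[p]`, in homogeneous coordinates. -/
noncomputable def chordalDist (a b : ℚ_[p] × ℚ_[p]) : ℝ :=
  ‖a.1 * b.2 - b.1 * a.2‖ / (‖a‖ * ‖b‖)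

lemma padic_norm_sub_le (a b : ℚ_[p]) : ‖a - b‖ ≤ max ‖a‖ ‖b‖ := by
  rw [sub_eq_add_neg, ← norm_neg b]
  exact Padic.nonarchimedean _ _

lemma chordalDist_comm (a b : ℚ_[p] × ℚ_[p]) : chordalDist a b = chordalDist b a := by
  rw [chordalDist, chordalDist, norm_sub_rev, mul_comm ‖a‖]

lemma norm_fst_mul_snd_le (a b : ℚ_[p] × ℚ_[p]) : ‖a.1 * b.2‖ ≤ ‖a‖ * ‖b‖ := by
  rw [norm_mul]
  exact mul_le_mul (norm_fst_le a) (norm_snd_le b) (norm_nonneg _) (norm_nonneg _)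

lemma chordalDist_le_one (a b : ℚ_[p] × ℚ_[p]) : chordalDist a b ≤ 1 := by
  refine div_le_one_of_le₀ ?_ (by positivity)
  refine (padic_norm_sub_le _ _).trans (max_le (norm_fst_mul_snd_le a b) ?_)
  rw [mul_comm ‖a‖]
  exact norm_fst_mul_snd_le b a

lemma chordalDist_pos {a b : ℚ_[p] × ℚ_[p]} (h : a.1 * b.2 - b.1 * a.2 ≠ 0) :
    0 < chordalDist a b := by
  have ha : a ≠ 0 := by
    rintro rfl
    simp at h
  have hb : b ≠ 0 := by
    rintro rfl
    simp at h
  have := norm_pos_iff.2 h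
  have := norm_pos_iff.2 ha
  have := norm_pos_iff.2 hb
  unfold chordalDist
  positivity

lemma chordalDist_le_max {a b c : ℚ_[p] × ℚ_[p]} (ha : a ≠ 0) (hb : b ≠ 0) (hc : c ≠ 0) :
    chordalDist a c ≤ max (chordalDist a b) (chordalDist b c) := by
  have ha' := norm_pos_iff.2 ha
  have hb' := norm_pos_iff.2 hb
  have hc' := norm_pos_iff.2 hc
  have e1 : ‖a.1 * b.2 - b.1 * a.2‖ = chordalDist a b * (‖a‖ * ‖b‖) := by
    rw [chordalDist, div_mul_cancel₀ _ (by positivity)]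
  have e2 : ‖b.1 * c.2 - c.1 * b.2‖ = chordalDist b c * (‖b‖ * ‖c‖) := by
    rw [chordalDist, div_mul_cancel₀ _ (by positivity)]
  have hD : 0 ≤ chordalDist a b := by
    unfold chordalDist
    positivity
  have hD' : 0 ≤ chordalDist b c := by
    unfold chordalDist
    positivity
  have key : ∀ w α γ : ℚ_[p], ‖α‖ ≤ ‖a‖ → ‖γ‖ ≤ ‖c‖ → (a.1 * c.2 - c.1 * a.2) * w =
      (a.1 * b.2 - b.1 * a.2) * γ + (b.1 * c.2 - c.1 * b.2) * α →
      ‖a.1 * c.2 - c.1 * a.2‖ * ‖w‖ ≤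
        max (chordalDist a b) (chordalDist b c) * (‖a‖ * ‖c‖) * ‖b‖ := by
    intro w α γ hα hγ h
    rw [← norm_mul, h]
    refine (Padic.nonarchimedean _ _).trans (max_le ?_ ?_)
    · rw [norm_mul, e1]
      calc _ ≤ max (chordalDist a b) (chordalDist b c) * (‖a‖ * ‖b‖) * ‖c‖ :=
            mul_le_mul (mul_le_mul_of_nonneg_right (le_max_left _ _) (by positivity)) hγ
              (norm_nonneg _) (by positivity)
        _ = _ := by ring
    · rw [norm_mul, e2]
      calc _ ≤ max (chordalDist a b) (chordalDist b c) * (‖b‖ * ‖c‖) * ‖a‖ :=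
            mul_le_mul (mul_le_mul_of_nonneg_right (le_max_right _ _) (by positivity)) hα
              (norm_nonneg _) (by positivity)
        _ = _ := by ring
  have h1 := key b.1 a.1 c.1 (norm_fst_le a) (norm_fst_le c) (by ring)
  have h2 := key b.2 a.2 c.2 (norm_snd_le a) (norm_snd_le c) (by ring)
  have h3 : ‖a.1 * c.2 - c.1 * a.2‖ * ‖b‖ ≤
      max (chordalDist a b) (chordalDist b c) * (‖a‖ * ‖c‖) * ‖b‖ := by
    rcases max_choice ‖b.1‖ ‖b.2‖ with h | h
    · rwa [← h, ← Prod.norm_def] at h1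
    · rwa [← h, ← Prod.norm_def] at h2
  rw [chordalDist, div_le_iff₀ (by positivity)]
  exact le_of_mul_le_mul_right h3 hb'

lemma exists_norm_prod_eq_zpow {a : ℚ_[p] × ℚ_[p]} (ha : a ≠ 0) :
    ∃ k : ℤ, ‖a‖ = (p : ℝ) ^ k := by
  have key : ∀ z : ℚ_[p], ‖a‖ = ‖z‖ → ∃ k : ℤ, ‖a‖ = (p : ℝ) ^ k := by
    intro z hz
    refine ⟨_, hz.trans (Padic.norm_eq_zpow_neg_valuation ?_)⟩
    rintro rfl
    exact ha (norm_eq_zero.1 (hz.trans norm_zero))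
  rcases max_choice ‖a.1‖ ‖a.2‖ with h | h
  · exact key a.1 ((Prod.norm_def a).trans h)
  · exact key a.2 ((Prod.norm_def a).trans h)

lemma exists_neg_log_chordalDist_eq {a b : ℚ_[p] × ℚ_[p]} (h : a.1 * b.2 - b.1 * a.2 ≠ 0) :
    ∃ k : ℕ, -Real.log (chordalDist a b) = k * Real.log p := by
  have hp0 : (0 : ℝ) < p := by exact_mod_cast (Fact.out : p.Prime).pos
  have hp1 : (1 : ℝ) < p := by exact_mod_cast (Fact.out : p.Prime).one_lt
  have ha : a ≠ 0 := by
    rintro rfl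
    simp at h
  have hb : b ≠ 0 := by
    rintro rfl
    simp at h
  obtain ⟨i, hi⟩ := exists_norm_prod_eq_zpow ha
  obtain ⟨j, hj⟩ := exists_norm_prod_eq_zpow hb
  have hk := Padic.norm_eq_zpow_neg_valuation h
  set v := (a.1 * b.2 - b.1 * a.2).valuation
  have e : chordalDist a b = (p : ℝ) ^ (-(v + i + j)) := by
    rw [chordalDist, hk, hi, hj, ← zpow_add₀ hp0.ne', ← zpow_sub₀ hp0.ne']
    congr 1
    ring
  have hnn : 0 ≤ v + i + j := by
    by_contra! hneg
    have := chordalDist_le_one a b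
    rw [e] at this
    exact absurd this (not_le.2 (one_lt_zpow₀ hp1 (by lia)))
  obtain ⟨k, hk⟩ := Int.eq_ofNat_of_zero_le hnn
  refine ⟨k, ?_⟩
  rw [e, hk, zpow_neg, Real.log_inv, neg_neg, zpow_natCast, Real.log_pow]

lemma exists_sum_mul_neg_log_chordalDist_le {V : Type*} [Fintype V] {P : V → ℚ_[p] × ℚ_[p]}
    (hP : ∀ u v, u ≠ v → (P u).1 * (P v).2 - (P v).1 * (P u).2 ≠ 0) (hP0 : ∀ u, P u ≠ 0)
    {r : V → ℕ} (hr : Function.Injective r) {W : V → V → ℝ} {t : ℝ} (ht : 0 ≤ t)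
    (hW0 : ∀ u, W u u = 0)
    (hW : ∀ S : Finset V, S.Nonempty →
      (∀ u ∈ S, ∀ v ∈ S, u ≠ v → chordalDist (P u) (P v) ≠ 1) →
      ∑ u ∈ S, ∑ v ∈ S, W u v ≤ 2 * t * (#S - 1)) :
    ∃ M : V → ℝ, (∑ u, ∑ v, W u v * -Real.log (chordalDist (P u) (P v)) ≤ 2 * t * ∑ v, M v) ∧
      ∀ v, ((∀ u, ¬ r u < r v) ∧ M v = 0) ∨
        ∃ u, r u < r v ∧ M v = -Real.log (chordalDist (P u) (P v)) := by
  classical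
  let _ : LinearOrder V := LinearOrder.lift' r hr
  have hlt : ∀ u v : V, u < v ↔ r u < r v := fun u v => Iff.rfl
  have hp1 : (1 : ℝ) < p := by exact_mod_cast (Fact.out : p.Prime).one_lt
  have hlog : 0 < Real.log p := Real.log_pos hp1
  have hex : ∀ u v, ∃ k : ℕ, u ≠ v → -Real.log (chordalDist (P u) (P v)) = k * Real.log p := by
    intro u v
    by_cases huv : u = v
    · exact ⟨0, fun h => absurd huv h⟩
    · obtain ⟨k, hk⟩ := exists_neg_log_chordalDist_eq (hP u v huv)
      exact ⟨k, fun _ => hk⟩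
  choose h hh using hex
  have hpos : ∀ u v, u ≠ v → 0 < chordalDist (P u) (P v) := fun u v huv =>
    chordalDist_pos (hP u v huv)
  have hsymm : ∀ u v, h u v = h v u := by
    intro u v
    by_cases huv : u = v
    · rw [huv]
    · have h1 := hh u v huv
      rw [chordalDist_comm, hh v u (Ne.symm huv)] at h1
      exact_mod_cast (mul_right_cancel₀ hlog.ne' h1).symm
  have hle : ∀ u v u' v', u ≠ v → u' ≠ v' →
      chordalDist (P u) (P v) ≤ chordalDist (P u') (P v') → h u' v' ≤ h u v := by
    intro u v u' v' h1 h2 h3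
    have h4 := Real.log_le_log (hpos u v h1) h3
    have h5 : (h u' v' : ℝ) * Real.log p ≤ h u v * Real.log p := by
      rw [← hh u v h1, ← hh u' v' h2]
      linarith
    exact_mod_cast le_of_mul_le_mul_right h5 hlog
  have hult : ∀ u v w, u ≠ w → min (h u v) (h v w) ≤ h u w := by
    intro u v w huw
    by_cases huv : u = v
    · subst huv
      exact min_le_right _ _
    by_cases hvw : v = w
    · subst hvw
      exact min_le_left _ _
    rcases le_max_iff.1 (chordalDist_le_max (hP0 u) (hP0 v) (hP0 w)) with h1 | h1
    · exact (min_le_left _ _).trans (hle _ _ _ _ huw huv h1)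
    · exact (min_le_right _ _).trans (hle _ _ _ _ huw hvw h1)
  let M : V → ℕ := fun v => (univ.filter (· < v)).sup (h · v)
  have hM : ∀ u v, u < v → h u v ≤ M v := fun u v huv =>
    le_sup (f := (h · v)) (mem_filter.2 ⟨mem_univ u, huv⟩)
  have key := sum_mul_le_of_ultrametric ht hsymm hult hM hW0 fun S hS hS' =>
    hW S hS fun u hu v hv huv h1 => by
      have h2 := hh u v huv
      rw [h1, Real.log_one, neg_zero, eq_comm, mul_eq_zero] at h2
      exact (hS' u hu v hv huv).ne' (by exact_mod_cast h2.resolve_right hlog.ne')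
  refine ⟨fun v => M v * Real.log p, ?_, fun v => ?_⟩
  · have e : ∑ u, ∑ v, W u v * -Real.log (chordalDist (P u) (P v)) =
        (∑ u, ∑ v, W u v * h u v) * Real.log p := by
      simp_rw [sum_mul]
      refine sum_congr rfl fun u _ => sum_congr rfl fun v _ => ?_
      by_cases huv : u = v
      · rw [huv, hW0, zero_mul, zero_mul, zero_mul]
      · rw [hh u v huv, mul_assoc]
    rw [e, ← sum_mul, ← mul_assoc]
    exact mul_le_mul_of_nonneg_right key hlog.le
  · rcases (univ.filter (· < v)).eq_empty_or_nonempty with he | hne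
    · refine Or.inl ⟨fun u hu => ?_, ?_⟩
      · have : u ∈ univ.filter (· < v) := mem_filter.2 ⟨mem_univ u, hu⟩
        rw [he] at this
        exact absurd this (notMem_empty u)
      · simp [M, he]
    · obtain ⟨u, hu, hu'⟩ := exists_mem_eq_sup _ hne (h · v)
      have huv : u < v := (mem_filter.1 hu).2
      refine Or.inr ⟨u, huv, ?_⟩
      rw [hh u v huv.ne, ← hu']

lemma norm_prod_one (z : ℚ_[p]) : ‖(z, (1 : ℚ_[p]))‖ = max ‖z‖ 1 := by
  rw [Prod.norm_mk, norm_one]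

lemma max_norm_one_rpow_le_padicProfile {t : ℝ} (ht : 0 < t) {z : ℚ_[p]} (hz : z ≠ 0) :
    (max ‖z‖ 1) ^ (t - 2) ≤ padicProfile p t z := by
  unfold padicProfile
  split_ifs with h
  · rw [max_eq_right h, Real.one_rpow]
    exact Real.one_le_rpow_of_pos_of_le_one_of_nonpos (norm_pos_iff.2 hz) h (by linarith)
  · rw [max_eq_left (not_le.1 h).le]

/-- Off the diagonal, the chordal kernel times the density of the invariant measure of the
projective line is bounded by two translates of the profile. -/
lemma chordalDist_rpow_mul_le {t : ℝ} (ht : 0 < t) (ht1 : t < 1) {v z : ℚ_[p]} (hz : z ≠ 0)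
    (hvz : v ≠ z) :
    chordalDist (v, 1) (z, 1) ^ (-t) * ‖(z, (1 : ℚ_[p]))‖ ^ (-2 : ℝ) ≤
      padicProfile p t z + padicProfile p t (z - v) := by
  have hd : 0 < ‖v - z‖ := norm_pos_iff.2 (sub_ne_zero.2 hvz)
  have hmz : 1 ≤ max ‖z‖ 1 := le_max_right _ _
  have hmv : 1 ≤ max ‖v‖ 1 := le_max_right _ _
  rw [chordalDist, norm_prod_one, norm_prod_one]
  simp only [mul_one]
  by_cases hm : max ‖v‖ 1 = max ‖z‖ 1
  · refine le_add_of_nonneg_of_le (padicProfile_nonneg _ _) ?_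
    have hle : ‖v - z‖ ≤ max ‖z‖ 1 :=
      (padic_norm_sub_le v z).trans (max_le (hm ▸ le_max_left _ _) (le_max_left _ _))
    rw [hm]
    set m := max ‖z‖ 1
    have hm0 : 0 < m := by linarith
    have e : (‖v - z‖ / (m * m)) ^ (-t) * m ^ (-2 : ℝ) = ‖v - z‖ ^ (-t) * m ^ (2 * t - 2) := by
      rw [Real.div_rpow hd.le (by positivity), Real.mul_rpow hm0.le hm0.le, div_eq_mul_inv,
        mul_assoc, ← Real.rpow_add hm0, ← Real.rpow_neg hm0.le, ← Real.rpow_add hm0]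
      ring_nf
    rw [e, padicProfile, norm_sub_rev z v]
    split_ifs with h1
    · exact mul_le_of_le_one_right (by positivity)
        (Real.rpow_le_one_of_one_le_of_nonpos hmz (by linarith))
    · calc _ ≤ ‖v - z‖ ^ (-t) * ‖v - z‖ ^ (2 * t - 2) :=
            mul_le_mul_of_nonneg_left (Real.rpow_le_rpow_of_nonpos hd hle (by linarith))
              (by positivity)
        _ = _ := by
            rw [← Real.rpow_add hd]
            ring_nf
  · refine le_add_of_le_of_nonneg ?_ (padicProfile_nonneg _ _)
    refine le_trans ?_ (max_norm_one_rpow_le_padicProfile ht hz)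
    have hlow : (max ‖z‖ 1)⁻¹ ≤ ‖v - z‖ / (max ‖v‖ 1 * max ‖z‖ 1) := by
      have hne : ‖v‖ ≠ ‖-z‖ := by
        rw [norm_neg]
        intro h
        exact hm (by rw [h])
      have hsub : ‖v - z‖ = max ‖v‖ ‖z‖ := by
        rw [sub_eq_add_neg, Padic.add_eq_max_of_ne hne, norm_neg]
      rw [hsub, inv_eq_one_div, div_le_div_iff₀ (by positivity) (by positivity), one_mul]
      refine mul_le_mul_of_nonneg_right (max_le (le_max_left _ _) ?_) (by positivity)
      by_contra! h
      rw [max_lt_iff] at h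
      exact hm (by rw [max_eq_right h.1.le, max_eq_right h.2.le])
    set m := max ‖z‖ 1
    have hm0 : 0 < m := by linarith
    calc _ ≤ m⁻¹ ^ (-t) * m ^ (-2 : ℝ) := mul_le_mul_of_nonneg_right
          (Real.rpow_le_rpow_of_nonpos (by positivity) hlow (by linarith)) (by positivity)
      _ = _ := by
          rw [Real.inv_rpow hm0.le, ← Real.rpow_neg hm0.le, ← Real.rpow_add hm0]
          ring_nf

lemma chordalDist_infty_rpow_mul_le {t : ℝ} (ht : 0 < t) {z : ℚ_[p]} (hz : z ≠ 0) :
    chordalDist (1, 0) (z, 1) ^ (-t) * ‖(z, (1 : ℚ_[p]))‖ ^ (-2 : ℝ) ≤ padicProfile p t z := by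
  refine le_trans (le_of_eq ?_) (max_norm_one_rpow_le_padicProfile ht hz)
  have hm0 : 0 < max ‖z‖ 1 := one_pos.trans_le (le_max_right _ _)
  have e : chordalDist ((1, 0) : ℚ_[p] × ℚ_[p]) (z, 1) = (max ‖z‖ 1)⁻¹ := by
    rw [chordalDist, norm_prod_one]
    simp [Prod.norm_mk]
  rw [e, norm_prod_one, Real.inv_rpow hm0.le, ← Real.rpow_neg hm0.le, ← Real.rpow_add hm0]
  ring_nf

end Chordal

section Pointwise

lemma sum_eq_two_mul_sum_filter_lt {n : ℕ} {f : Fin n → Fin n → ℝ} (h0 : ∀ i, f i i = 0)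
    (hs : ∀ i j, f i j = f j i) :
    ∑ i, ∑ j, f i j =
      2 * ∑ q ∈ univ.filter (fun q : Fin n × Fin n => q.1 < q.2), f q.1 q.2 := by
  have e : ∑ i, ∑ j, f i j = ∑ i, ∑ j, (if i < j then f i j else 0) +
      ∑ i, ∑ j, (if j < i then f i j else 0) := by
    simp_rw [← sum_add_distrib]
    refine sum_congr rfl fun i _ => sum_congr rfl fun j _ => ?_
    rcases lt_trichotomy i j with h | rfl | h
    · simp [h, h.not_gt]
    · simp [h0]
    · simp [h, h.not_gt]
  have e' : ∑ i, ∑ j, (if j < i then f i j else 0) = ∑ i, ∑ j, (if i < j then f i j else 0) := by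
    rw [sum_comm]
    refine sum_congr rfl fun i _ => sum_congr rfl fun j _ => ?_
    rw [hs]
  rw [e, e', ← two_mul, sum_filter, Fintype.sum_prod_type]

variable {p : ℕ} [Fact p.Prime] {n : ℕ}

/-- The points `∞, 0, 1` and the variables, in homogeneous coordinates. -/
noncomputable def markedPoint (x : Fin n → ℚ_[p]) : Fin 3 ⊕ Fin n → ℚ_[p] × ℚ_[p] :=
  Sum.elim ![(1, 0), (0, 1), (1, 1)] fun j => (x j, 1)

lemma markedPoint_ne_zero (x : Fin n → ℚ_[p]) (u : Fin 3 ⊕ Fin n) : markedPoint x u ≠ 0 := by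
  rcases u with i | j
  · fin_cases i <;> simp [markedPoint]
  · simp [markedPoint]

lemma markedPoint_det_ne_zero {x : Fin n → ℚ_[p]} (hx0 : ∀ j, x j ≠ 0) (hx1 : ∀ j, x j ≠ 1)
    (hx : Function.Injective x) (u v : Fin 3 ⊕ Fin n) (huv : u ≠ v) :
    (markedPoint x u).1 * (markedPoint x v).2 - (markedPoint x v).1 * (markedPoint x u).2 ≠ 0 := by
  rcases u with i | i <;> rcases v with j | j
  · fin_cases i <;> fin_cases j <;> simp [markedPoint] at huv ⊢
  · fin_cases i <;> simp [markedPoint, hx0, sub_eq_zero, (hx1 _).symm]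
  · fin_cases j <;> simp [markedPoint, hx0, sub_eq_zero, hx1]
  · have : x i ≠ x j := fun h => huv (congrArg _ (hx h))
    simpa [markedPoint, sub_eq_zero] using this

lemma chordalDist_markedPoint_inl (x : Fin n → ℚ_[p]) {i j : Fin 3} (h : i ≠ j) :
    chordalDist (markedPoint x (.inl i)) (markedPoint x (.inl j)) = 1 := by
  fin_cases i <;> fin_cases j <;> simp [markedPoint, chordalDist, Prod.norm_mk] at h ⊢

lemma neg_log_chordalDist {a b : ℚ_[p] × ℚ_[p]} (h : a.1 * b.2 - b.1 * a.2 ≠ 0)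
    (ha : a ≠ 0) (hb : b ≠ 0) :
    -Real.log (chordalDist a b) =
      Real.log ‖a‖ + Real.log ‖b‖ - Real.log ‖a.1 * b.2 - b.1 * a.2‖ := by
  have ha' := norm_ne_zero_iff.2 ha
  have hb' := norm_ne_zero_iff.2 hb
  rw [chordalDist, Real.log_div (norm_ne_zero_iff.2 h) (mul_ne_zero ha' hb'),
    Real.log_mul ha' hb']
  ring

variable {E : Fin 3 → Fin n → ℝ} {C : Fin n → Fin n → ℝ}

/-- The logarithm of the Koba-Nielsen integrand, written with chordal distances. -/
lemma sum_pointWeight_mul_neg_log_chordalDist {x : Fin n → ℚ_[p]} (hC0 : ∀ j, C j j = 0)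
    (hCs : ∀ i j, C i j = C j i) (h0 : ∀ j, E 0 j = 2 - E 1 j - E 2 j - ∑ i, C i j)
    (hx0 : ∀ j, x j ≠ 0) (hx1 : ∀ j, x j ≠ 1) (hx : Function.Injective x) :
    ∑ u, ∑ v, pointWeight E C u v *
        -Real.log (chordalDist (markedPoint x u) (markedPoint x v)) =
      2 * (2 * ∑ j, Real.log ‖(x j, (1 : ℚ_[p]))‖ + (∑ j, Real.log ‖x j‖ * -E 1 j +
        ∑ j, Real.log ‖1 - x j‖ * -E 2 j +
        ∑ q ∈ univ.filter (fun q : Fin n × Fin n => q.1 < q.2),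
          Real.log ‖x q.1 - x q.2‖ * -C q.1 q.2)) := by
  set m : Fin n → ℝ := fun j => Real.log ‖(x j, (1 : ℚ_[p]))‖ with hm
  have hD := markedPoint_det_ne_zero hx0 hx1 hx
  have hN := markedPoint_ne_zero x
  have g0 : ∀ j, -Real.log (chordalDist (markedPoint x (.inl 0)) (markedPoint x (.inr j))) =
      m j := by
    intro j
    rw [neg_log_chordalDist (hD _ _ (by simp)) (hN _) (hN _)]
    simp [markedPoint, hm, Prod.norm_mk]
  have g1 : ∀ j, -Real.log (chordalDist (markedPoint x (.inl 1)) (markedPoint x (.inr j))) =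
      m j - Real.log ‖x j‖ := by
    intro j
    rw [neg_log_chordalDist (hD _ _ (by simp)) (hN _) (hN _)]
    simp [markedPoint, hm, Prod.norm_mk]
  have g2 : ∀ j, -Real.log (chordalDist (markedPoint x (.inl 2)) (markedPoint x (.inr j))) =
      m j - Real.log ‖1 - x j‖ := by
    intro j
    rw [neg_log_chordalDist (hD _ _ (by simp)) (hN _) (hN _)]
    simp [markedPoint, hm, Prod.norm_mk]
  have g3 : ∀ i j, C i j *
      -Real.log (chordalDist (markedPoint x (.inr i)) (markedPoint x (.inr j))) =
      C i j * m i + C i j * m j + Real.log ‖x i - x j‖ * -C i j := by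
    intro i j
    rcases eq_or_ne i j with rfl | hij
    · simp [hC0]
    rw [neg_log_chordalDist (hD _ _ (by simpa using hij)) (hN _) (hN _)]
    simp [markedPoint, hm]
    ring
  have hsym : ∑ i, ∑ j, Real.log ‖x i - x j‖ * -C i j =
      2 * ∑ q ∈ univ.filter (fun q : Fin n × Fin n => q.1 < q.2),
        Real.log ‖x q.1 - x q.2‖ * -C q.1 q.2 :=
    sum_eq_two_mul_sum_filter_lt (f := fun i j => Real.log ‖x i - x j‖ * -C i j)
      (fun i => by simp) fun i j => by rw [hCs i j, norm_sub_rev]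
  have hcm : ∑ i, ∑ j, C i j * m i = ∑ i, ∑ j, C j i * m i :=
    sum_congr rfl fun i _ => sum_congr rfl fun j _ => by rw [hCs]
  have hcm' : ∑ i, ∑ j, C i j * m j = ∑ i, ∑ j, C j i * m i := sum_comm
  have hfin : ∑ i, ∑ j, C i j *
      -Real.log (chordalDist (markedPoint x (.inr i)) (markedPoint x (.inr j))) =
      2 * ∑ i, ∑ j, C j i * m i + 2 * ∑ q ∈ univ.filter (fun q : Fin n × Fin n => q.1 < q.2),
        Real.log ‖x q.1 - x q.2‖ * -C q.1 q.2 := by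
    simp_rw [g3, sum_add_distrib]
    rw [hcm, hcm', hsym]
    ring
  have hmix : ∀ j, ∑ i, E i j *
      -Real.log (chordalDist (markedPoint x (.inl i)) (markedPoint x (.inr j))) =
      2 * m j + Real.log ‖x j‖ * -E 1 j + Real.log ‖1 - x j‖ * -E 2 j - ∑ i, C i j * m j := by
    intro j
    rw [Fin.sum_univ_three, g0, g1, g2, h0, ← sum_mul]
    ring
  have hmix' : ∑ i, ∑ j, E i j *
      -Real.log (chordalDist (markedPoint x (.inl i)) (markedPoint x (.inr j))) =
      2 * ∑ j, m j + ∑ j, Real.log ‖x j‖ * -E 1 j + ∑ j, Real.log ‖1 - x j‖ * -E 2 j -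
        ∑ j, ∑ i, C i j * m j := by
    rw [sum_comm]
    simp_rw [hmix, sum_sub_distrib, sum_add_distrib, mul_sum]
  have hmix'' : ∑ j, ∑ i, E i j *
      -Real.log (chordalDist (markedPoint x (.inr j)) (markedPoint x (.inl i))) =
      ∑ i, ∑ j, E i j *
      -Real.log (chordalDist (markedPoint x (.inl i)) (markedPoint x (.inr j))) := by
    rw [sum_comm]
    exact sum_congr rfl fun i _ => sum_congr rfl fun j _ => by rw [chordalDist_comm]
  simp only [Fintype.sum_sum_type, pointWeight, zero_mul, sum_const_zero, zero_add,
    sum_add_distrib]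
  rw [hfin, hmix'', hmix']
  ring

lemma chordalDist_markedPoint_rpow_mul_le_padicMajorant {t : ℝ} (ht : 0 < t) (ht1 : t < 1)
    {x : Fin n → ℚ_[p]} (hx0 : ∀ j, x j ≠ 0) (hx1 : ∀ j, x j ≠ 1) (hx : Function.Injective x)
    {j : Fin n} {u : Fin 3 ⊕ Fin n} (hu : ∀ i, u = .inr i → i < j) :
    chordalDist (markedPoint x u) (x j, 1) ^ (-t) * ‖(x j, (1 : ℚ_[p]))‖ ^ (-2 : ℝ) ≤
      padicMajorant t x j := by
  have hΦ := padicProfile_nonneg (p := p) t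
  have h1 := hΦ (x j)
  have h2 := hΦ (x j - 1)
  have h3 : 0 ≤ ∑ i, if i < j then padicProfile p t (x j - x i) else 0 :=
    sum_nonneg fun i _ => by split_ifs <;> simp [hΦ]
  unfold padicMajorant
  rcases u with i | i
  · fin_cases i
    · have := chordalDist_infty_rpow_mul_le ht (hx0 j)
      simp only [markedPoint, Sum.elim_inl]
      exact this.trans (by linarith)
    · have := chordalDist_rpow_mul_le ht ht1 (hx0 j) (hx0 j).symm
      rw [sub_zero] at this
      exact this.trans (by linarith)
    · have := chordalDist_rpow_mul_le ht ht1 (hx0 j) (hx1 j).symm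
      exact this.trans (by linarith)
  · have hij := hu i rfl
    have := chordalDist_rpow_mul_le ht ht1 (hx0 j) (hx.ne hij.ne)
    have h4 : padicProfile p t (x j - x i) ≤
        ∑ i, if i < j then padicProfile p t (x j - x i) else 0 := by
      refine le_trans (by rw [if_pos hij])
        (single_le_sum (f := fun i => if i < j then padicProfile p t (x j - x i) else 0)
          (fun i _ => ?_) (mem_univ i))
      split_ifs <;> simp [hΦ]
    exact this.trans (by linarith)

lemma prod_rpow_le_prod_padicMajorant {t : ℝ} (ht : 0 < t) (ht1 : t < 1) (hC0 : ∀ j, C j j = 0)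
    (hCs : ∀ i j, C i j = C j i) (h0 : ∀ j, E 0 j = 2 - E 1 j - E 2 j - ∑ i, C i j)
    (hS : ∀ S : Finset (Fin 3 ⊕ Fin n), S.Nonempty →
      (∀ i j : Fin 3, .inl i ∈ S → .inl j ∈ S → i = j) →
      ∑ u ∈ S, ∑ v ∈ S, pointWeight E C u v ≤ 2 * t * (#S - 1))
    {x : Fin n → ℚ_[p]} (hx0 : ∀ j, x j ≠ 0) (hx1 : ∀ j, x j ≠ 1) (hx : Function.Injective x) :
    (∏ j, ‖x j‖ ^ (-E 1 j)) * (∏ j, ‖1 - x j‖ ^ (-E 2 j)) *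
        ∏ q ∈ univ.filter (fun q : Fin n × Fin n => q.1 < q.2), ‖x q.1 - x q.2‖ ^ (-C q.1 q.2) ≤
      ∏ j, padicMajorant t x j := by
  have hD := markedPoint_det_ne_zero hx0 hx1 hx
  obtain ⟨M, hM, hMv⟩ := exists_sum_mul_neg_log_chordalDist_le (V := Fin 3 ⊕ Fin n)
    (P := markedPoint x) hD (markedPoint_ne_zero x)
    (r := Sum.elim (fun i => i) fun j => j + 3)
    (Function.Injective.sumElim Fin.val_injective
      (fun i j h => Fin.ext (Nat.add_right_cancel h)) fun i j => by
        have := i.isLt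
        lia)
    (W := pointWeight E C) ht.le (pointWeight_self hC0) fun S hne hd => hS S hne fun i j hi hj => by
      by_contra hij
      exact hd _ hi _ hj (by simpa using hij) (chordalDist_markedPoint_inl x hij)
  rw [sum_pointWeight_mul_neg_log_chordalDist hC0 hCs h0 hx0 hx1 hx] at hM
  have hinl : ∀ i : Fin 3, M (.inl i) = 0 := by
    intro i
    rcases hMv (.inl i) with h | ⟨u | u, hu, h⟩
    · exact h.2
    · have hui : u ≠ i := by
        rintro rfl
        exact lt_irrefl _ hu
      rw [h, chordalDist_markedPoint_inl x hui, Real.log_one, neg_zero]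
    · have := i.isLt
      simp only [Sum.elim_inl, Sum.elim_inr] at hu
      lia
  have hpos : ∀ {z : ℚ_[p]} (_ : z ≠ 0) (s : ℝ), ‖z‖ ^ s = Real.exp (Real.log ‖z‖ * s) :=
    fun hz s => Real.rpow_def_of_pos (norm_pos_iff.2 hz) s
  have e1 : ∀ j, ‖x j‖ ^ (-E 1 j) = Real.exp (Real.log ‖x j‖ * -E 1 j) := fun j => hpos (hx0 j) _
  have e2 : ∀ j, ‖1 - x j‖ ^ (-E 2 j) = Real.exp (Real.log ‖1 - x j‖ * -E 2 j) :=
    fun j => hpos (sub_ne_zero.2 (hx1 j).symm) _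
  have e3 : ∏ q ∈ univ.filter (fun q : Fin n × Fin n => q.1 < q.2),
      ‖x q.1 - x q.2‖ ^ (-C q.1 q.2) =
      ∏ q ∈ univ.filter (fun q : Fin n × Fin n => q.1 < q.2),
        Real.exp (Real.log ‖x q.1 - x q.2‖ * -C q.1 q.2) :=
    prod_congr rfl fun q hq => hpos (sub_ne_zero.2 (hx.ne (mem_filter.1 hq).2.ne)) _
  simp_rw [e1, e2]
  rw [e3, ← Real.exp_sum, ← Real.exp_sum, ← Real.exp_sum, ← Real.exp_add, ← Real.exp_add]
  have hfac : ∀ j, Real.exp (t * M (.inr j) + Real.log ‖(x j, (1 : ℚ_[p]))‖ * -2) ≤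
      padicMajorant t x j := by
    intro j
    rcases hMv (.inr j) with h | ⟨u, hu, h⟩
    · exact absurd (Nat.succ_pos _) (h.1 (.inl 0))
    · have huj : u ≠ .inr j := by
        rintro rfl
        exact lt_irrefl _ hu
      have key := chordalDist_markedPoint_rpow_mul_le_padicMajorant ht ht1 hx0 hx1 hx (j := j)
        (u := u) (by
          rintro i rfl
          simpa using hu)
      refine le_trans (le_of_eq ?_) key
      have hc : 0 < chordalDist (markedPoint x u) (x j, 1) := chordalDist_pos (hD u (.inr j) huj)
      rw [Real.rpow_def_of_pos hc, Real.rpow_def_of_pos (norm_pos_iff.2 (by simp)), ← Real.exp_add,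
        h]
      congr 2
      simp only [markedPoint, Sum.elim_inr]
      ring
  refine le_trans ?_ (prod_le_prod (fun j _ => (Real.exp_pos _).le) fun j _ => hfac j)
  rw [← Real.exp_sum, Real.exp_le_exp, sum_add_distrib, ← mul_sum, ← sum_mul]
  simp only [Fintype.sum_sum_type, hinl, sum_const_zero, zero_add] at hM
  linarith

end Pointwise

section Integrand

variable {p : ℕ} [Fact p.Prime] {N : ℕ} {a b : Fin (N - 3) → ℂ} {c : Fin (N - 3) → Fin (N - 3) → ℂ}

lemma measurable_KNintegrandPadic [MeasurableSpace ℚ_[p]] [BorelSpace ℚ_[p]] :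
    Measurable (KNintegrandPadic p N a b c) := by
  have h : ∀ {f : (Fin (N - 3) → ℚ_[p]) → ℚ_[p]} (_ : Measurable f) (s : ℂ),
      Measurable fun x => ((‖f x‖ : ℝ) : ℂ) ^ s := fun hf s =>
    (Complex.measurable_ofReal.comp hf.norm).pow_const s
  unfold KNintegrandPadic
  refine ((Finset.measurable_fun_prod _ fun j _ => h (measurable_pi_apply j) _).mul
    (Finset.measurable_fun_prod _ fun j _ => h ((measurable_pi_apply j).const_sub 1) _)).mul
    (Finset.measurable_fun_prod _ fun q _ =>
      h ((measurable_pi_apply q.1).sub (measurable_pi_apply q.2)) _)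

lemma KNintegrandPadic_eq_zero (ha : ∀ j, (a j).re < 0) (hb : ∀ j, (b j).re < 0)
    (hc : ∀ i j, i < j → (c i j).re < 0) {x : Fin (N - 3) → ℚ_[p]}
    (hx : ¬((∀ j, x j ≠ 0) ∧ (∀ j, x j ≠ 1) ∧ Function.Injective x)) :
    KNintegrandPadic p N a b c x = 0 := by
  have hz : ∀ {z : ℚ_[p]} {s : ℂ} (_ : z = 0) (_ : s.re < 0), ((‖z‖ : ℝ) : ℂ) ^ s = 0 := by
    rintro z s rfl hs
    rw [norm_zero, Complex.ofReal_zero, Complex.zero_cpow]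
    rintro rfl
    exact lt_irrefl _ hs
  unfold KNintegrandPadic
  by_cases h0 : ∃ j, x j = 0
  · obtain ⟨j, hj⟩ := h0
    rw [prod_eq_zero (mem_univ j) (hz hj (ha j)), zero_mul, zero_mul]
  by_cases h1 : ∃ j, x j = 1
  · obtain ⟨j, hj⟩ := h1
    rw [prod_eq_zero (s := univ) (f := fun j => ((‖1 - x j‖ : ℝ) : ℂ) ^ b j) (mem_univ j)
      (hz (sub_eq_zero.2 hj.symm) (hb j)), mul_zero, zero_mul]
  · obtain ⟨i, j, hij, hlt⟩ : ∃ i j, x i = x j ∧ i < j := by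
      by_contra! h
      exact hx ⟨not_exists.1 h0, not_exists.1 h1, fun i j hij =>
        le_antisymm (h j i hij.symm) (h i j hij)⟩
    rw [prod_eq_zero (i := (i, j)) (mem_filter.2 ⟨mem_univ _, hlt⟩)
      (hz (sub_eq_zero.2 hij) (hc i j hlt)), mul_zero]

lemma norm_KNintegrandPadic {x : Fin (N - 3) → ℚ_[p]} (hx0 : ∀ j, x j ≠ 0) (hx1 : ∀ j, x j ≠ 1)
    (hx : Function.Injective x) :
    ‖KNintegrandPadic p N a b c x‖ =
      (∏ j, ‖x j‖ ^ (a j).re) * (∏ j, ‖1 - x j‖ ^ (b j).re) *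
        ∏ q ∈ univ.filter (fun q : Fin (N - 3) × Fin (N - 3) => q.1 < q.2),
          ‖x q.1 - x q.2‖ ^ (c q.1 q.2).re := by
  have h : ∀ {z : ℚ_[p]} (_ : z ≠ 0) (s : ℂ), ‖((‖z‖ : ℝ) : ℂ) ^ s‖ = ‖z‖ ^ s.re := fun hz s =>
    Complex.norm_cpow_eq_rpow_re_of_pos (norm_pos_iff.2 hz) s
  rw [KNintegrandPadic, norm_mul, norm_mul, norm_prod, norm_prod, norm_prod]
  congr 1
  · congr 1
    · exact prod_congr rfl fun j _ => h (hx0 j) _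
    · exact prod_congr rfl fun j _ => h (sub_ne_zero.2 (hx1 j).symm) _
  · exact prod_congr rfl fun q hq => h (sub_ne_zero.2 (hx.ne (mem_filter.1 hq).2.ne)) _

lemma exists_norm_KNintegrandPadic_le (hN : 4 ≤ N)
    (ha : ∀ j, -2 / ((N : ℝ) - 2) < (a j).re ∧ (a j).re < -2 / (N : ℝ))
    (hb : ∀ j, -2 / ((N : ℝ) - 2) < (b j).re ∧ (b j).re < -2 / (N : ℝ))
    (hc : ∀ i j, i < j → -2 / ((N : ℝ) - 2) < (c i j).re ∧ (c i j).re < -2 / (N : ℝ)) :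
    ∃ t : ℝ, 0 < t ∧ t < 1 ∧ ∀ x : Fin (N - 3) → ℚ_[p],
      ‖KNintegrandPadic p N a b c x‖ ≤ ∏ j, padicMajorant t x j := by
  have hN0 : (0 : ℝ) < N := by
    exact_mod_cast (by lia : 0 < N)
  have hcast : ((N - 3 : ℕ) : ℝ) = (N : ℝ) - 3 := by
    rw [Nat.cast_sub (by lia)]
    norm_num
  have hbound : ∀ {s : ℂ}, (-2 / ((N : ℝ) - 2) < s.re ∧ s.re < -2 / (N : ℝ)) →
      2 / (((N - 3 : ℕ) : ℝ) + 3) < -s.re ∧ -s.re < 2 / (((N - 3 : ℕ) : ℝ) + 1) := by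
    rintro s ⟨h1, h2⟩
    rw [hcast, sub_add_cancel, show (N : ℝ) - 3 + 1 = N - 2 by ring]
    rw [neg_div] at h1 h2
    constructor <;> linarith
  have hneg : ∀ {s : ℂ}, s.re < -2 / (N : ℝ) → s.re < 0 := fun h =>
    h.trans (div_neg_of_neg_of_pos (by norm_num) hN0)
  set C : Fin (N - 3) → Fin (N - 3) → ℝ := fun i j =>
    if i < j then -(c i j).re else if j < i then -(c j i).re else 0 with hC
  have hC0 : ∀ j, C j j = 0 := fun j => by simp [hC]
  have hCs : ∀ i j, C i j = C j i := by
    intro i j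
    rcases lt_trichotomy i j with h | rfl | h
    · simp [hC, h, h.not_gt]
    · rfl
    · simp [hC, h, h.not_gt]
  have hClt : ∀ i j, i < j → C i j = -(c i j).re := fun i j h => by simp [hC, h]
  have hCb : ∀ i j, i ≠ j →
      2 / (((N - 3 : ℕ) : ℝ) + 3) < C i j ∧ C i j < 2 / (((N - 3 : ℕ) : ℝ) + 1) := by
    intro i j hij
    rcases hij.lt_or_gt with h | h
    · rw [hClt i j h]
      exact hbound (hc i j h)
    · rw [hCs, hClt j i h]
      exact hbound (hc j i h)
  obtain ⟨E, hE1, hE2, hE0⟩ : ∃ E : Fin 3 → Fin (N - 3) → ℝ, (∀ j, E 1 j = -(a j).re) ∧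
      (∀ j, E 2 j = -(b j).re) ∧ ∀ j, E 0 j = 2 - E 1 j - E 2 j - ∑ i, C i j :=
    ⟨![fun j => 2 - -(a j).re - -(b j).re - ∑ i, C i j, fun j => -(a j).re, fun j => -(b j).re],
      fun _ => rfl, fun _ => rfl, fun _ => rfl⟩
  obtain ⟨t, ht, ht1, hS⟩ := exists_lt_one_sum_pointWeight_le hC0 hCb
    (fun j => (hE1 j).symm ▸ hbound (ha j)) (fun j => (hE2 j).symm ▸ hbound (hb j)) hE0
  refine ⟨t, ht, ht1, fun x => ?_⟩
  by_cases hx : (∀ j, x j ≠ 0) ∧ (∀ j, x j ≠ 1) ∧ Function.Injective x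
  · obtain ⟨hx0, hx1, hx⟩ := hx
    refine le_trans (le_of_eq ?_) (prod_rpow_le_prod_padicMajorant ht ht1 hC0 hCs hE0 hS hx0 hx1 hx)
    rw [norm_KNintegrandPadic hx0 hx1 hx]
    simp_rw [hE1, hE2, neg_neg]
    congr 1
    exact prod_congr rfl fun q hq => by rw [hClt _ _ (mem_filter.1 hq).2, neg_neg]
  · rw [KNintegrandPadic_eq_zero (fun j => hneg (ha j).2) (fun j => hneg (hb j).2)
      (fun i j h => hneg (hc i j h).2) hx, norm_zero]
    exact prod_nonneg fun j _ => padicMajorant_nonneg _ _ _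

end Integrand

/-- For a prime `p` and `N ≥ 4`, the `p`-adic Koba-Nielsen local zeta function, defined
with the additive Haar measure `μ` on `ℚ_p` normalized so that `ℤ_p = {‖x‖ ≤ 1}` has
measure `1`, converges (the integrand is absolutely integrable over `ℚ_p^{N-3}`) whenever
`-2/(N-2) < Re(s_{ij}) < -2/N` for every index pair `ij`. -/
theorem kobaNielsen_padic_convergent (p : ℕ) [Fact p.Prime] (N : ℕ) (hN : 4 ≤ N)
    [MeasurableSpace ℚ_[p]] [BorelSpace ℚ_[p]]
    (μ : Measure ℚ_[p]) [μ.IsAddHaarMeasure] [SigmaFinite μ]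
    (hμ : μ {x : ℚ_[p] | ‖x‖ ≤ 1} = 1)
    (a b : Fin (N - 3) → ℂ) (c : Fin (N - 3) → Fin (N - 3) → ℂ)
    (ha : ∀ j, -2 / ((N : ℝ) - 2) < (a j).re ∧ (a j).re < -2 / (N : ℝ))
    (hb : ∀ j, -2 / ((N : ℝ) - 2) < (b j).re ∧ (b j).re < -2 / (N : ℝ))
    (hc : ∀ i j, i < j → -2 / ((N : ℝ) - 2) < (c i j).re ∧ (c i j).re < -2 / (N : ℝ)) :
    Integrable (KNintegrandPadic p N a b c) (Measure.pi fun _ => μ) := by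
  obtain ⟨t, ht, ht1, hle⟩ := exists_norm_KNintegrandPadic_le (p := p) hN ha hb hc
  refine ⟨measurable_KNintegrandPadic.aestronglyMeasurable, ?_⟩
  refine lt_of_le_of_lt (lintegral_mono fun x => ?_)
    (lintegral_prod_padicMajorant_lt_top μ hμ ht ht1 (N - 3))
  rw [← ofReal_norm]
  exact ENNReal.ofReal_le_ofReal (hle x)
end

section
/- For complex numbers a and b with Re(a) > −1, Re(b) > −1, and Re(a) + Re(b) < −1, the integral ∫_ℂ (|x|²)^{a} (|1−x|²)^{b} dx over ℂ with Lebesgue measure converges, i.e., the function x ↦ |x|^{2 Re a} |1−x|^{2 Re b} is integrable on ℂ ≅ ℝ². -/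
open MeasureTheory

/-- If `u` is comparable to `v > 0`, then every real power of `u` is bounded by a multiple of the
same power of `v`. -/
theorem Real.rpow_le_max_mul_rpow {m M u v : ℝ} (hm : 0 < m) (hv : 0 < v) (h₁ : m * v ≤ u)
    (h₂ : u ≤ M * v) (t : ℝ) : u ^ t ≤ max (m ^ t) (M ^ t) * v ^ t := by
  have hu : 0 < u := (mul_pos hm hv).trans_le h₁
  have hM : 0 < M := pos_of_mul_pos_left (hu.trans_le h₂) hv.le
  rcases le_total 0 t with ht | ht
  · calc u ^ t ≤ (M * v) ^ t := Real.rpow_le_rpow hu.le h₂ ht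
      _ = M ^ t * v ^ t := Real.mul_rpow hM.le hv.le
      _ ≤ _ := by gcongr; exact le_max_right _ _
  · calc u ^ t ≤ (m * v) ^ t := Real.rpow_le_rpow_of_nonpos (mul_pos hm hv) h₁ ht
      _ = m ^ t * v ^ t := Real.mul_rpow hm.le hv.le
      _ ≤ _ := by gcongr; exact le_max_left _ _

theorem integrableOn_ball_norm_rpow_mul_norm_one_sub_rpow {s : ℝ} (hs : -2 < s) (t : ℝ) :
    IntegrableOn (fun x : ℂ => ‖x‖ ^ s * ‖1 - x‖ ^ t) (Metric.ball 0 (1 / 2)) := by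
  refine integrableOn_ball_of_norm_le_rpow (α := -s) (C := max ((1 / 2) ^ t) ((3 / 2) ^ t))
    (by simp) (by simp; linarith) ?_ (by fun_prop)
  filter_upwards [ae_restrict_mem Metric.isOpen_ball.measurableSet] with x hx
  rw [mem_ball_zero_iff] at hx
  have h₁ : 1 - ‖x‖ ≤ ‖1 - x‖ := by simpa using norm_sub_norm_le (1 : ℂ) x
  have h₂ : ‖1 - x‖ ≤ 1 + ‖x‖ := by simpa using norm_sub_le (1 : ℂ) x
  have h := Real.rpow_le_max_mul_rpow (m := 1 / 2) (M := 3 / 2) (u := ‖1 - x‖) (v := 1)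
    (by norm_num) one_pos (by linarith) (by linarith) t
  rw [Real.one_rpow, mul_one] at h
  rw [Real.norm_of_nonneg (by positivity), neg_neg, mul_comm]
  gcongr

theorem integrableOn_compl_norm_rpow_mul_norm_one_sub_rpow {s t : ℝ} (hst : s + t < -2) :
    IntegrableOn (fun x : ℂ => ‖x‖ ^ s * ‖1 - x‖ ^ t)
      (Metric.ball 0 (1 / 2) ∪ (fun x => 1 - x) ⁻¹' Metric.ball 0 (1 / 2))ᶜ := by
  have hint : Integrable (fun x : ℂ => (1 + ‖x‖) ^ (-(-(s + t)))) :=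
    integrable_one_add_norm (by simp; linarith)
  refine Integrable.mono' (hint.const_mul
    (max ((1 / 5) ^ s) (1 ^ s) * max ((1 / 5) ^ t) (1 ^ t))).integrableOn (by fun_prop) ?_
  have hmeas : MeasurableSet ((fun x : ℂ => 1 - x) ⁻¹' Metric.ball 0 (1 / 2)) :=
    Metric.isOpen_ball.measurableSet.preimage (by fun_prop)
  filter_upwards [ae_restrict_mem (Metric.isOpen_ball.measurableSet.union hmeas).compl] with x hx
  simp only [Set.mem_compl_iff, Set.mem_union, Set.mem_preimage, mem_ball_zero_iff, not_or,
    not_lt] at hx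
  obtain ⟨hx₀, hx₁⟩ := hx
  have h₁ : ‖x‖ - 1 ≤ ‖1 - x‖ := by simpa [norm_sub_rev] using norm_sub_norm_le x (1 : ℂ)
  have h₂ : ‖1 - x‖ ≤ 1 + ‖x‖ := by simpa using norm_sub_le (1 : ℂ) x
  have hv : 0 < 1 + ‖x‖ := by positivity
  have hs := Real.rpow_le_max_mul_rpow (m := 1 / 5) (M := 1) (u := ‖x‖)
    (by norm_num) hv (by linarith) (by linarith) s
  have ht := Real.rpow_le_max_mul_rpow (m := 1 / 5) (M := 1) (u := ‖1 - x‖)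
    (by norm_num) hv (by linarith) (by linarith) t
  rw [Real.norm_of_nonneg (by positivity), neg_neg, Real.rpow_add hv, mul_mul_mul_comm]
  gcongr

/-- For complex `a`, `b` with `Re a > -1`, `Re b > -1` and `Re a + Re b < -1`, the integral
`∫_ℂ (|x|²)^a (|1-x|²)^b dx` over `ℂ` with Lebesgue measure converges, i.e. the function
`x ↦ |x|^{2 Re a} |1-x|^{2 Re b}` is integrable on `ℂ ≅ ℝ²`. -/
theorem complex_veneziano_integral_convergence (a b : ℂ)
    (ha : -1 < a.re) (hb : -1 < b.re) (hab : a.re + b.re < -1) :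
    Integrable (fun x : ℂ => ‖x‖ ^ (2 * a.re) * ‖1 - x‖ ^ (2 * b.re)) := by
  have h₀ := integrableOn_ball_norm_rpow_mul_norm_one_sub_rpow
    (s := 2 * a.re) (by linarith) (2 * b.re)
  have h₁ : IntegrableOn (fun x : ℂ => ‖x‖ ^ (2 * a.re) * ‖1 - x‖ ^ (2 * b.re))
      ((fun x => 1 - x) ⁻¹' Metric.ball 0 (1 / 2)) := by
    have h := ((Measure.measurePreserving_sub_left volume (1 : ℂ)).integrableOn_comp_preimage
      (MeasurableEquiv.subLeft (1 : ℂ)).measurableEmbedding).2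
      (integrableOn_ball_norm_rpow_mul_norm_one_sub_rpow (s := 2 * b.re) (by linarith) (2 * a.re))
    simpa [Function.comp_def, mul_comm] using h
  have h₂ := integrableOn_compl_norm_rpow_mul_norm_one_sub_rpow
    (s := 2 * a.re) (t := 2 * b.re) (by linarith)
  rw [← integrableOn_univ, ← Set.union_compl_self]
  exact (h₀.union h₁).union h₂
end
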